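/- Let G be a locally finite, connected metric graph with finite total length L > 0, finite diameter D > 0, and finite Betti number. Then the first nontrivial eigenvalue of the Neumann extension satisfies μ_2(G) ≥ 2/(LD). -/

import Mathlib

open MeasureTheory Set Filter
open scoped ENNReal

/-- A metric graph structure on a metric space `X`: a countable collection of edges,
each parametrised by arc length over `[0, len e]`, together with vertices identified
with edge endpoints; the interiors of distinct edges are disjoint, the edges cover `X`,
and the metric of `X` is the induced path metric (characterised by the fact that the
edge parametrisations are `1`-Lipschitz and `dist x y` is the largest value `u x - u y`
over all continuous, edgewise `1`-Lipschitz functions `u : X → ℝ`). -/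
structure MetricGraphOn (X : Type) [MetricSpace X] where
  V : Type
  E : Type
  countableV : Countable V
  countableE : Countable E
  len : E → ℝ
  len_pos : ∀ e, 0 < len e
  edgeMap : E → ℝ → X
  vertexMap : V → X
  endpoint : E → Bool → V
  edgeMap_cont : ∀ e, ContinuousOn (edgeMap e) (Icc 0 (len e))
  edgeMap_injOn : ∀ e, InjOn (edgeMap e) (Ico 0 (len e))
  edgeMap_zero : ∀ e, edgeMap e 0 = vertexMap (endpoint e false)
  edgeMap_len : ∀ e, edgeMap e (len e) = vertexMap (endpoint e true)
  interior_disjoint : ∀ e e', e ≠ e' → ∀ s ∈ Ioo 0 (len e), ∀ t ∈ Ioo 0 (len e'),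
    edgeMap e s ≠ edgeMap e' t
  interior_not_vertex : ∀ e, ∀ s ∈ Ioo 0 (len e), ∀ v, edgeMap e s ≠ vertexMap v
  vertexMap_inj : Function.Injective vertexMap
  cover : ∀ x : X, ∃ e, ∃ t ∈ Icc 0 (len e), edgeMap e t = x
  dist_le : ∀ e, ∀ s ∈ Icc 0 (len e), ∀ t ∈ Icc 0 (len e),
    dist (edgeMap e s) (edgeMap e t) ≤ |s - t|
  dist_ge : ∀ u : X → ℝ, Continuous u →
    (∀ e, ∀ s ∈ Icc 0 (len e), ∀ t ∈ Icc 0 (len e),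
      |u (edgeMap e s) - u (edgeMap e t)| ≤ |s - t|) →
    ∀ x y, u x - u y ≤ dist x y

namespace MetricGraphOn

variable {X : Type} [MetricSpace X]

/-- The (a.e. defined) derivative of `f` along the edge `e`, in the arc-length
parametrisation of the edge. -/
noncomputable def edgeDeriv (G : MetricGraphOn X) (f : X → ℝ) (e : G.E) : ℝ → ℝ :=
  deriv (f ∘ G.edgeMap e)

/-- The subset of `X` consisting of the (closed) edges in `A`. -/
def subgraphSet (G : MetricGraphOn X) (A : Set G.E) : Set X :=
  ⋃ e ∈ A, G.edgeMap e '' Icc 0 (G.len e)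

/-- `∫_e |f|²` along a single edge. -/
noncomputable def edgeMass (G : MetricGraphOn X) (f : X → ℝ) (e : G.E) : ℝ :=
  ∫ t in Ioo 0 (G.len e), (f (G.edgeMap e t)) ^ 2

/-- `∫_e |f'|²` along a single edge. -/
noncomputable def edgeEnergy (G : MetricGraphOn X) (f : X → ℝ) (e : G.E) : ℝ :=
  ∫ t in Ioo 0 (G.len e), (G.edgeDeriv f e t) ^ 2

/-- Membership in the Sobolev space `H¹` of the subgraph given by the edge set `A`:
continuity on the subgraph, edgewise absolute continuity with square-integrable
derivative, and finiteness of the total `H¹` norm. -/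
def MemH1On (G : MetricGraphOn X) (A : Set G.E) (f : X → ℝ) : Prop :=
  ContinuousOn f (G.subgraphSet A) ∧
  (∀ e ∈ A, IntegrableOn (fun t => (G.edgeDeriv f e t) ^ 2) (Ioo 0 (G.len e))) ∧
  (∀ e ∈ A, ∀ t ∈ Icc (0:ℝ) (G.len e),
    f (G.edgeMap e t) = f (G.edgeMap e 0) + ∫ s in Ioo 0 t, G.edgeDeriv f e s) ∧
  Summable (fun e : A => G.edgeMass f (e : G.E) + G.edgeEnergy f (e : G.E))

/-- Membership in `H¹(G)`. -/
def MemH1 (G : MetricGraphOn X) (f : X → ℝ) : Prop :=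
  Continuous f ∧ G.MemH1On Set.univ f

/-- The squared `L²` norm of `f` over the edges in `A`. -/
noncomputable def l2normSqOn (G : MetricGraphOn X) (A : Set G.E) (f : X → ℝ) : ℝ :=
  ∑' e : A, G.edgeMass f (e : G.E)

/-- The squared `L²` norm of `f'` over the edges in `A`. -/
noncomputable def derivNormSqOn (G : MetricGraphOn X) (A : Set G.E) (f : X → ℝ) : ℝ :=
  ∑' e : A, G.edgeEnergy f (e : G.E)

/-- The squared `L²` norm of `f` on `G`. -/
noncomputable def l2normSq (G : MetricGraphOn X) (f : X → ℝ) : ℝ :=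
  G.l2normSqOn Set.univ f

/-- The squared `L²` norm of `f'` on `G` (the Dirichlet energy of `f`). -/
noncomputable def derivNormSq (G : MetricGraphOn X) (f : X → ℝ) : ℝ :=
  G.derivNormSqOn Set.univ f

/-- The squared `H¹` norm of `f`. -/
noncomputable def h1normSq (G : MetricGraphOn X) (f : X → ℝ) : ℝ :=
  G.l2normSq f + G.derivNormSq f

/-- The `L²` inner product on `G`. -/
noncomputable def l2inner (G : MetricGraphOn X) (f g : X → ℝ) : ℝ :=
  ∑' e : G.E, ∫ t in Ioo 0 (G.len e), f (G.edgeMap e t) * g (G.edgeMap e t)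

/-- The Dirichlet form (inner product of derivatives) on `G`. -/
noncomputable def derivInner (G : MetricGraphOn X) (f g : X → ℝ) : ℝ :=
  ∑' e : G.E, ∫ t in Ioo 0 (G.len e), G.edgeDeriv f e t * G.edgeDeriv g e t

/-- The `k`-th min-max (Courant–Fischer) value of the quadratic form
`f ↦ ∫ |f'|²` (over the edges of `A`) with form domain `K`: the infimum over all
`k`-dimensional subspaces of `K` of the largest Rayleigh quotient on the subspace.
For a self-adjoint Laplacian with purely discrete spectrum this is its `k`-th
eigenvalue (`k = 1` giving the lowest one). -/
noncomputable def eigenOn (G : MetricGraphOn X) (A : Set G.E) (K : Set (X → ℝ))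
    (k : ℕ) : ℝ :=
  sInf { μ : ℝ | ∃ φ : Fin k → X → ℝ, (∀ i, φ i ∈ K) ∧
    LinearIndependent ℝ (fun i => (G.subgraphSet A).restrict (φ i)) ∧
    ∀ c : Fin k → ℝ,
      G.derivNormSqOn A (∑ i, c i • φ i) ≤ μ * G.l2normSqOn A (∑ i, c i • φ i) }

/-- The `k`-th eigenvalue `μ_k(G)` of the Neumann extension (standard
continuity–Kirchhoff conditions at all vertices, Neumann conditions at all ends). -/
noncomputable def neumannEigen (G : MetricGraphOn X) (k : ℕ) : ℝ :=
  G.eigenOn Set.univ {f | G.MemH1 f} k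

/-- `f` vanishes at the point `y` of the completion of `X`. -/
def VanishesAt (f : X → ℝ) (y : UniformSpace.Completion X) : Prop :=
  Tendsto f (comap ((↑) : X → UniformSpace.Completion X) (nhds y)) (nhds 0)

/-- Membership in `H¹₀(G; 𝔙)`: `H¹`-functions vanishing on the set `𝔙` of
vertices and/or ends (viewed inside the completion of `X`). -/
def H10Mem (G : MetricGraphOn X) (𝔙 : Set (UniformSpace.Completion X))
    (f : X → ℝ) : Prop :=
  G.MemH1 f ∧ ∀ y ∈ 𝔙, VanishesAt f y

/-- The `k`-th eigenvalue `λ_k(G; 𝔙)` of the Laplacian with Dirichlet conditions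
on `𝔙` and standard (continuity–Kirchhoff/Neumann) conditions elsewhere. -/
noncomputable def dirichletEigen (G : MetricGraphOn X)
    (𝔙 : Set (UniformSpace.Completion X)) (k : ℕ) : ℝ :=
  G.eigenOn Set.univ {f | G.H10Mem 𝔙 f} k

/-- The set of (topological = graph) ends of `G`, realised as the points of the
completion of `X` that do not belong to `X`. -/
def Ends (_G : MetricGraphOn X) : Set (UniformSpace.Completion X) :=
  {y | y ∉ Set.range ((↑) : X → UniformSpace.Completion X)}

/-- The set of vertices of `G`, viewed inside the completion of `X`. -/
def vertexPoints (G : MetricGraphOn X) : Set (UniformSpace.Completion X) :=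
  Set.range (fun v => ((G.vertexMap v : X) : UniformSpace.Completion X))

/-- The degree of a vertex (loops counted twice). -/
noncomputable def degree (G : MetricGraphOn X) (v : G.V) : ℕ :=
  {p : G.E × Bool | G.endpoint p.1 p.2 = v}.ncard

/-- `G` is locally finite: every vertex has finite degree. -/
def LocallyFinite (G : MetricGraphOn X) : Prop :=
  ∀ v : G.V, {p : G.E × Bool | G.endpoint p.1 p.2 = v}.Finite

/-- A cycle in `G`: a compact subset homeomorphic to a circle. -/
def IsCycle (_G : MetricGraphOn X) (C : Set X) : Prop :=
  IsCompact C ∧ Nonempty (C ≃ₜ Metric.sphere (0 : ℝ × ℝ) 1)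

/-- `G` has (first) Betti number `β`: there is a minimal finite family of `β` cycles
whose union contains every cycle of `G`. -/
def HasBettiNumber (G : MetricGraphOn X) (β : ℕ) : Prop :=
  ∃ 𝒞 : Finset (Set X), 𝒞.card = β ∧ (∀ C ∈ 𝒞, G.IsCycle C) ∧
    (∀ C, G.IsCycle C → C ⊆ ⋃ C' ∈ 𝒞, C') ∧
    ∀ 𝒞' : Finset (Set X), (∀ C ∈ 𝒞', G.IsCycle C) →
      (∀ C, G.IsCycle C → C ⊆ ⋃ C' ∈ 𝒞', C') → β ≤ 𝒞'.card

/-- The embedding of `K ⊆ H¹(G)` into `L²(G)` is compact: every sequence in `K`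
bounded in the `H¹` norm has a subsequence which is Cauchy in the `L²` norm. -/
def CompactlyEmbedded (G : MetricGraphOn X) (K : Set (X → ℝ)) : Prop :=
  ∀ u : ℕ → X → ℝ, (∀ n, u n ∈ K) → (∀ n, G.h1normSq (u n) ≤ 1) →
    ∃ φ : ℕ → ℕ, StrictMono φ ∧
      ∀ ε : ℝ, 0 < ε → ∃ N, ∀ m, N ≤ m → ∀ n, N ≤ n →
        G.l2normSq (u (φ m) - u (φ n)) ≤ ε

/-- The self-adjoint operator with form `f ↦ ∫ |f'|²` and form domain `K` has
purely discrete spectrum (equivalently, compact resolvent): its min-max values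
tend to `+∞`. -/
def HasPurelyDiscreteSpectrumOn (G : MetricGraphOn X) (K : Set (X → ℝ)) : Prop :=
  Tendsto (fun k => G.eigenOn Set.univ K k) atTop atTop

/-- The volume (total length) of a subset `S` of `G`. -/
noncomputable def vol (G : MetricGraphOn X) (S : Set X) : ℝ≥0∞ :=
  ∑' e : G.E, volume (G.edgeMap e ⁻¹' S ∩ Ioo 0 (G.len e))

/-- The set of vertices incident to some edge in `A`. -/
def vertexSetOf (G : MetricGraphOn X) (A : Set G.E) : Set G.V :=
  {v | ∃ e ∈ A, ∃ b, G.endpoint e b = v}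

/-- Membership in `H¹₀(G)`, the closure in `H¹(G)` of the compactly supported
`H¹` functions (the form domain of the Friedrichs extension). -/
def H100Mem (G : MetricGraphOn X) (f : X → ℝ) : Prop :=
  G.MemH1 f ∧ ∃ u : ℕ → X → ℝ, (∀ n, G.MemH1 (u n) ∧ HasCompactSupport (u n)) ∧
    Tendsto (fun n => G.h1normSq (f - u n)) atTop (nhds 0)

/-- The `k`-th eigenvalue `λ_k(G)` of the Friedrichs extension. -/
noncomputable def friedrichsEigen (G : MetricGraphOn X) (k : ℕ) : ℝ :=
  G.eigenOn Set.univ {f | G.H100Mem f} k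

end MetricGraphOn

/-- A continuous function has an excursion from `g s` to `g t`, on an interval between `s` and `t`,
whose interior values lie strictly between `g s` and `g t`. -/
theorem exists_excursion_of_le {g : ℝ → ℝ} {s t : ℝ} (hst : s ≤ t)
    (hg : ContinuousOn g (Icc s t)) :
    ∃ p q, s ≤ p ∧ p ≤ q ∧ q ≤ t ∧ g t - g s ≤ g q - g p ∧
      ∀ τ ∈ Ioo p q, g s < g τ ∧ g τ < g t := by
  have hc1 : IsClosed (Icc s t ∩ g ⁻¹' Iic (g s)) :=
    hg.preimage_isClosed_of_isClosed isClosed_Icc isClosed_Iic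
  obtain ⟨p, ⟨hpm, hp⟩, hpmax⟩ := (isCompact_Icc.of_isClosed_subset hc1
    inter_subset_left).exists_isGreatest ⟨s, left_mem_Icc.2 hst, le_refl (g s)⟩
  have hg2 : ContinuousOn g (Icc p t) := hg.mono (Icc_subset_Icc_left hpm.1)
  have hc2 : IsClosed (Icc p t ∩ g ⁻¹' Ici (g t)) :=
    hg2.preimage_isClosed_of_isClosed isClosed_Icc isClosed_Ici
  obtain ⟨q, ⟨hqm, hq⟩, hqmin⟩ := (isCompact_Icc.of_isClosed_subset hc2
    inter_subset_left).exists_isLeast ⟨t, right_mem_Icc.2 hpm.2, le_refl (g t)⟩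
  refine ⟨p, q, hpm.1, hqm.1, hqm.2, sub_le_sub hq hp, fun τ hτ => ⟨?_, ?_⟩⟩
  · by_contra! h
    exact absurd (hpmax ⟨⟨hpm.1.trans hτ.1.le, hτ.2.le.trans hqm.2⟩, h⟩) (not_le.2 hτ.1)
  · by_contra! h
    exact absurd (hqmin ⟨⟨hτ.1.le, hτ.2.le.trans hqm.2⟩, h⟩) (not_le.2 hτ.2)

/-- The version of `exists_excursion_of_le` for `s` and `t` in either order. -/
theorem exists_excursion {g : ℝ → ℝ} {s t : ℝ} (hg : ContinuousOn g (uIcc s t)) :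
    ∃ p q, min s t ≤ p ∧ p ≤ q ∧ q ≤ max s t ∧ g t - g s ≤ |g q - g p| ∧
      ∀ τ ∈ Ioo p q, g s < g τ ∧ g τ < g t := by
  rcases le_total s t with hst | hst
  · rw [uIcc_of_le hst] at hg
    obtain ⟨p, q, h1, h2, h3, h4, h5⟩ := exists_excursion_of_le hst hg
    exact ⟨p, q, by simpa [hst], h2, by simpa [hst], h4.trans (le_abs_self _), h5⟩
  · rw [uIcc_of_ge hst] at hg
    have hg' : ContinuousOn (fun x => g (-x)) (Icc (-s) (-t)) :=
      hg.comp continuous_neg.continuousOn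
        fun x hx => ⟨by linarith [hx.2], by linarith [hx.1]⟩
    obtain ⟨p, q, h1, h2, h3, h4, h5⟩ :=
      exists_excursion_of_le (neg_le_neg hst) hg'
    simp only [neg_neg] at h4 h5
    refine ⟨-q, -p, ?_, by linarith, ?_, ?_, fun τ hτ => ?_⟩
    · rw [min_eq_right hst]; linarith
    · rw [max_eq_left hst]; linarith
    · rw [abs_sub_comm]; exact h4.trans (le_abs_self _)
    · simpa using h5 (-τ) ⟨by linarith [hτ.2], by linarith [hτ.1]⟩

/-- A function on `[0, l]` that is the integral of its square-integrable derivative. -/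
structure IsH1On (g : ℝ → ℝ) (l : ℝ) : Prop where
  continuousOn : ContinuousOn g (Icc 0 l)
  integrableOn_sq : IntegrableOn (fun t => deriv g t ^ 2) (Ioo 0 l)
  eq_integral : ∀ t ∈ Icc 0 l, g t = g 0 + ∫ s in Ioo 0 t, deriv g s

namespace IsH1On

variable {g h : ℝ → ℝ} {l : ℝ}

theorem integrableOn_sq_Icc (hg : IsH1On g l) :
    IntegrableOn (fun t => deriv g t ^ 2) (Icc 0 l) :=
  (integrableOn_Icc_iff_integrableOn_Ioo (by simp) (by simp)).2 hg.integrableOn_sq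

theorem integrableOn_deriv (hg : IsH1On g l) : IntegrableOn (deriv g) (Icc 0 l) := by
  have h2 : MemLp (deriv g) 2 (volume.restrict (Icc 0 l)) :=
    (memLp_two_iff_integrable_sq (measurable_deriv g).aestronglyMeasurable).2 hg.integrableOn_sq_Icc
  exact h2.integrable (by norm_num)

theorem intervalIntegrable_deriv (hg : IsH1On g l) {p q : ℝ} (hp : p ∈ Icc 0 l)
    (hq : q ∈ Icc 0 l) : IntervalIntegrable (deriv g) volume p q :=
  (hg.integrableOn_deriv.mono_set (uIcc_subset_Icc hp hq)).intervalIntegrable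

theorem eq_intervalIntegral (hg : IsH1On g l) {t : ℝ} (ht : t ∈ Icc 0 l) :
    g t = g 0 + ∫ s in (0 : ℝ)..t, deriv g s := by
  rw [intervalIntegral.integral_of_le ht.1, integral_Ioc_eq_integral_Ioo]
  exact hg.eq_integral t ht

theorem sub_eq_integral (hg : IsH1On g l) {p q : ℝ} (hp : p ∈ Icc 0 l) (hq : q ∈ Icc 0 l) :
    g q - g p = ∫ s in p..q, deriv g s := by
  have h0 : (0 : ℝ) ∈ Icc 0 l := ⟨le_rfl, hp.1.trans hp.2⟩
  rw [hg.eq_intervalIntegral hp, hg.eq_intervalIntegral hq,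
    ← intervalIntegral.integral_interval_sub_left (hg.intervalIntegrable_deriv h0 hq)
      (hg.intervalIntegrable_deriv h0 hp)]
  ring

theorem abs_sub_le (hg : IsH1On g l) {a : ℝ} (ha : 0 < a) {p q : ℝ} (hp : p ∈ Icc 0 l)
    (hq : q ∈ Icc 0 l) (hpq : p ≤ q) :
    |g q - g p| ≤ a * (q - p) + (∫ s in Ioo p q, deriv g s ^ 2) / (4 * a) := by
  have hsub : Ioc p q ⊆ Icc 0 l := fun x hx => ⟨hp.1.trans hx.1.le, hx.2.trans hq.2⟩
  have hI := hg.integrableOn_sq_Icc.mono_set hsub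
  rw [hg.sub_eq_integral hp hq, ← integral_Ioc_eq_integral_Ioo]
  calc |∫ s in p..q, deriv g s| ≤ ∫ s in p..q, |deriv g s| :=
        intervalIntegral.abs_integral_le_integral_abs hpq
    _ = ∫ s in Ioc p q, |deriv g s| := intervalIntegral.integral_of_le hpq
    _ ≤ ∫ s in Ioc p q, (a + deriv g s ^ 2 / (4 * a)) := by
        refine integral_mono (hg.integrableOn_deriv.mono_set hsub).abs
          ((integrable_const a).add (hI.div_const _)) fun s => ?_
        have h4 : 0 < 4 * a := by positivity
        show |deriv g s| ≤ a + deriv g s ^ 2 / (4 * a)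
        rw [← sub_le_iff_le_add', le_div_iff₀ h4, ← sq_abs (deriv g s)]
        nlinarith [sq_nonneg (|deriv g s| - 2 * a)]
    _ = a * (q - p) + (∫ s in Ioc p q, deriv g s ^ 2) / (4 * a) := by
        rw [integral_add (integrable_const a) (hI.div_const _), integral_div]
        simp [hpq, mul_comm]

/-- The energy of `g` over its sublevel set at height `r`. -/
noncomputable def sublevelEnergy (g : ℝ → ℝ) (l r : ℝ) : ℝ :=
  ∫ s in Icc 0 l ∩ g ⁻¹' Iic r, deriv g s ^ 2

theorem sublevelEnergy_nonneg (g : ℝ → ℝ) (l r : ℝ) : 0 ≤ sublevelEnergy g l r :=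
  integral_nonneg fun _ => sq_nonneg _

theorem sublevelEnergy_le (hg : IsH1On g l) (r : ℝ) :
    sublevelEnergy g l r ≤ ∫ s in Ioo 0 l, deriv g s ^ 2 := by
  rw [← integral_Icc_eq_integral_Ioo]
  exact setIntegral_mono_set hg.integrableOn_sq_Icc (ae_of_all _ fun _ => sq_nonneg _)
    (LE.le.eventuallyLE inter_subset_left)

theorem setIntegral_le_sublevelEnergy_sub (hg : IsH1On g l) {a b : ℝ} (hab : a ≤ b) {s : Set ℝ}
    (hs : s ⊆ Icc 0 l ∩ g ⁻¹' Ioc a b) :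
    ∫ τ in s, deriv g τ ^ 2 ≤ sublevelEnergy g l b - sublevelEnergy g l a := by
  have hsub : Icc 0 l ∩ g ⁻¹' Iic a ⊆ Icc 0 l ∩ g ⁻¹' Iic b :=
    inter_subset_inter_right _ (preimage_mono (Iic_subset_Iic.2 hab))
  have hb := hg.integrableOn_sq_Icc.mono_set
    (inter_subset_left : Icc 0 l ∩ g ⁻¹' Iic b ⊆ Icc 0 l)
  have hm : MeasurableSet (Icc 0 l ∩ g ⁻¹' Iic a) :=
    (hg.continuousOn.preimage_isClosed_of_isClosed isClosed_Icc isClosed_Iic).measurableSet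
  rw [sublevelEnergy, sublevelEnergy, ← setIntegral_sdiff hm hb hsub]
  refine setIntegral_mono_set (hb.mono_set sdiff_subset) (ae_of_all _ fun _ => sq_nonneg _)
    (LE.le.eventuallyLE fun x hx => ?_)
  obtain ⟨h1, h2, h3⟩ := hs hx
  exact ⟨⟨h1, h3⟩, fun h => absurd h.2 (not_le.2 h2)⟩

theorem sublevelEnergy_mono (hg : IsH1On g l) : Monotone (sublevelEnergy g l) := fun a b hab => by
  simpa using hg.setIntegral_le_sublevelEnergy_sub hab (empty_subset _)

theorem sub_sublevelEnergy_le (hg : IsH1On g l) {a : ℝ} (ha : 0 < a) {s t : ℝ} (hs : s ∈ Icc 0 l)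
    (ht : t ∈ Icc 0 l) (hlt : g s < g t) :
    g t - g s - (sublevelEnergy g l (g t) - sublevelEnergy g l (g s)) / (4 * a) ≤
      a * |s - t| := by
  have hsub : uIcc s t ⊆ Icc 0 l := uIcc_subset_Icc hs ht
  obtain ⟨p, q, h1, h2, h3, h4, h5⟩ := exists_excursion (hg.continuousOn.mono hsub)
  have hp : p ∈ Icc 0 l := hsub ⟨h1, h2.trans h3⟩
  have hq : q ∈ Icc 0 l := hsub ⟨h1.trans h2, h3⟩
  have h6 := hg.abs_sub_le ha hp hq h2
  have h7 := hg.setIntegral_le_sublevelEnergy_sub hlt.le (s := Ioo p q) fun τ hτ =>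
    ⟨⟨hp.1.trans hτ.1.le, hτ.2.le.trans hq.2⟩, (h5 τ hτ).1, (h5 τ hτ).2.le⟩
  have h8 : a * (q - p) ≤ a * |s - t| := by
    gcongr
    rw [← max_sub_min_eq_abs']
    linarith
  have h9 := div_le_div_of_nonneg_right h7 (by positivity : 0 ≤ 4 * a)
  linarith

end IsH1On

/-- The running supremum of `A`. -/
noncomputable def runningSup (A : ℝ → ℝ) (r : ℝ) : ℝ := sSup (A '' Iic r)

section runningSup

variable {A : ℝ → ℝ}

theorem bddAbove_image_Iic (hA : ∀ q, A q ≤ q) (r : ℝ) : BddAbove (A '' Iic r) :=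
  ⟨r, by rintro _ ⟨q, hq, rfl⟩; exact (hA q).trans hq⟩

theorem le_runningSup (hA : ∀ q, A q ≤ q) {q r : ℝ} (h : q ≤ r) : A q ≤ runningSup A r :=
  le_csSup (bddAbove_image_Iic hA r) ⟨q, h, rfl⟩

theorem runningSup_le {r c : ℝ} (h : ∀ q ≤ r, A q ≤ c) : runningSup A r ≤ c :=
  csSup_le (nonempty_Iic.image A) (by rintro _ ⟨q, hq, rfl⟩; exact h q hq)

theorem runningSup_mono (hA : ∀ q, A q ≤ q) : Monotone (runningSup A) := fun _ _ h =>
  runningSup_le fun _ hq => le_runningSup hA (hq.trans h)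

theorem runningSup_le_add (hA : ∀ q, A q ≤ q) {r r' K : ℝ} (hK : 0 ≤ K)
    (h : ∀ q ∈ Ioc r r', A q ≤ A r + K) : runningSup A r' ≤ runningSup A r + K := by
  refine runningSup_le fun q hq => ?_
  rcases le_or_gt q r with hqr | hqr
  · linarith [le_runningSup hA hqr]
  · linarith [h q ⟨hqr, hq⟩, le_runningSup hA (le_refl r)]

theorem continuous_runningSup (hA : ∀ q, A q ≤ q) (hA1 : ∀ r q, r ≤ q → A q ≤ A r + (q - r)) :
    Continuous (runningSup A) := by
  have key : ∀ r r', r ≤ r' → |runningSup A r' - runningSup A r| ≤ |r' - r| := fun r r' h => by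
    rw [abs_of_nonneg (sub_nonneg.2 (runningSup_mono hA h)), abs_of_nonneg (sub_nonneg.2 h),
      sub_le_iff_le_add']
    exact runningSup_le_add hA (sub_nonneg.2 h) fun q hq => by linarith [hA1 r q hq.1.le, hq.2]
  refine (LipschitzWith.of_dist_le_mul (K := 1) fun x y => ?_).continuous
  rw [NNReal.coe_one, one_mul, Real.dist_eq, Real.dist_eq]
  rcases le_total x y with h | h
  · rw [abs_sub_comm, abs_sub_comm x]; exact key x y h
  · exact key y x h

end runningSup

namespace IsH1On

variable {g h : ℝ → ℝ} {l : ℝ}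

theorem ae_hasDerivAt (hg : IsH1On g l) :
    ∀ᵐ t ∂volume.restrict (Ioo 0 l), HasDerivAt g (deriv g t) t := by
  rcases le_or_gt l 0 with hl | hl
  · simp [Ioo_eq_empty (not_lt.2 hl)]
  have h0 : (0 : ℝ) ∈ Icc 0 l := ⟨le_rfl, hl.le⟩
  have hl' : l ∈ Icc 0 l := ⟨hl.le, le_rfl⟩
  rw [ae_restrict_iff' measurableSet_Ioo]
  filter_upwards [(hg.intervalIntegrable_deriv h0 hl').ae_hasDerivAt_integral] with t ht htm
  rw [uIcc_of_le hl.le] at ht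
  refine ((ht (Ioo_subset_Icc_self htm) 0 h0).const_add (g 0)).congr_of_eventuallyEq ?_
  filter_upwards [Icc_mem_nhds htm.1 htm.2] with s hs using hg.eq_intervalIntegral hs

theorem deriv_linearCombination_ae (hg : IsH1On g l) (hh : IsH1On h l) (a b : ℝ) :
    deriv (fun t => a * g t + b * h t) =ᵐ[volume.restrict (Ioo 0 l)]
      fun t => a * deriv g t + b * deriv h t := by
  filter_upwards [hg.ae_hasDerivAt, hh.ae_hasDerivAt] with t h1 h2
  exact ((h1.const_mul a).add (h2.const_mul b)).deriv

theorem sq_deriv_linearCombination_ae_le (hg : IsH1On g l) (hh : IsH1On h l) (a b : ℝ) :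
    ∀ᵐ t ∂volume.restrict (Ioo 0 l), deriv (fun t => a * g t + b * h t) t ^ 2 ≤
      2 * a ^ 2 * deriv g t ^ 2 + 2 * b ^ 2 * deriv h t ^ 2 := by
  filter_upwards [hg.deriv_linearCombination_ae hh a b] with t ht
  rw [ht]
  nlinarith [sq_nonneg (a * deriv g t - b * deriv h t)]

theorem integrable_sq_bound (hg : IsH1On g l) (hh : IsH1On h l) (a b : ℝ) :
    Integrable (fun t => 2 * a ^ 2 * deriv g t ^ 2 + 2 * b ^ 2 * deriv h t ^ 2)
      (volume.restrict (Ioo 0 l)) :=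
  (hg.integrableOn_sq.const_mul _).add (hh.integrableOn_sq.const_mul _)

theorem linearCombination (hg : IsH1On g l) (hh : IsH1On h l) (a b : ℝ) :
    IsH1On (fun t => a * g t + b * h t) l where
  continuousOn := (continuousOn_const.mul hg.continuousOn).add
    (continuousOn_const.mul hh.continuousOn)
  integrableOn_sq := by
    refine (hg.integrable_sq_bound hh a b).mono'
      ((measurable_deriv _).pow_const 2).aestronglyMeasurable ?_
    filter_upwards [hg.sq_deriv_linearCombination_ae_le hh a b] with t ht
    rwa [Real.norm_of_nonneg (sq_nonneg _)]
  eq_integral t ht := by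
    have hsub : Ioo 0 t ⊆ Ioo 0 l := Ioo_subset_Ioo_right ht.2
    rw [integral_congr_ae (ae_restrict_of_ae_restrict_of_subset hsub
        (hg.deriv_linearCombination_ae hh a b)), integral_add, integral_const_mul,
      integral_const_mul, hg.eq_integral t ht, hh.eq_integral t ht]
    · ring
    · exact (hg.integrableOn_deriv.mono_set (hsub.trans Ioo_subset_Icc_self)).const_mul a
    · exact (hh.integrableOn_deriv.mono_set (hsub.trans Ioo_subset_Icc_self)).const_mul b

theorem integral_sq_deriv_linearCombination_le (hg : IsH1On g l) (hh : IsH1On h l) (a b : ℝ) :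
    ∫ t in Ioo 0 l, deriv (fun t => a * g t + b * h t) t ^ 2 ≤
      2 * a ^ 2 * (∫ t in Ioo 0 l, deriv g t ^ 2) +
        2 * b ^ 2 * ∫ t in Ioo 0 l, deriv h t ^ 2 := by
  rw [← integral_const_mul, ← integral_const_mul,
    ← integral_add (hg.integrableOn_sq.const_mul _) (hh.integrableOn_sq.const_mul _)]
  exact integral_mono_ae (hg.linearCombination hh a b).integrableOn_sq
    (hg.integrable_sq_bound hh a b) (hg.sq_deriv_linearCombination_ae_le hh a b)

end IsH1On

theorem LipschitzOnWith.sq_deriv_le_one {g : ℝ → ℝ} {l : ℝ} (hg : LipschitzOnWith 1 g (Icc 0 l))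
    {t : ℝ} (ht : t ∈ Ioo 0 l) : deriv g t ^ 2 ≤ 1 := by
  rw [sq_le_one_iff_abs_le_one]
  simpa using norm_deriv_le_of_lipschitzOn (Icc_mem_nhds ht.1 ht.2) hg

theorem LipschitzOnWith.isH1On {g : ℝ → ℝ} {l : ℝ} (hg : LipschitzOnWith 1 g (Icc 0 l)) :
    IsH1On g l where
  continuousOn := hg.continuousOn
  integrableOn_sq := by
    refine Integrable.mono' (integrable_const (1 : ℝ))
      ((measurable_deriv _).pow_const 2).aestronglyMeasurable ?_
    refine (ae_restrict_iff' measurableSet_Ioo).2 (ae_of_all _ fun t ht => ?_)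
    rw [Real.norm_of_nonneg (sq_nonneg _)]
    exact hg.sq_deriv_le_one ht
  eq_integral t ht := by
    have hac : AbsolutelyContinuousOnInterval g 0 t :=
      (hg.mono (by rw [uIcc_of_le ht.1]; exact Icc_subset_Icc_right ht.2)
        ).absolutelyContinuousOnInterval
    rw [← integral_Ioc_eq_integral_Ioo, ← intervalIntegral.integral_of_le ht.1,
      hac.integral_deriv_eq_sub]
    ring

theorem LipschitzOnWith.integral_sq_deriv_le {g : ℝ → ℝ} {l : ℝ} (hl : 0 ≤ l)
    (hg : LipschitzOnWith 1 g (Icc 0 l)) : ∫ t in Ioo 0 l, deriv g t ^ 2 ≤ l := by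
  calc ∫ t in Ioo 0 l, deriv g t ^ 2 ≤ ∫ _ in Ioo 0 l, (1 : ℝ) :=
        setIntegral_mono_on hg.isH1On.integrableOn_sq (integrable_const _) measurableSet_Ioo
          fun t ht => hg.sq_deriv_le_one ht
    _ = l := by simp [hl]

namespace MetricGraphOn

variable {X : Type} [MetricSpace X] {G : MetricGraphOn X} {f h : X → ℝ}

theorem subgraphSet_univ (G : MetricGraphOn X) : G.subgraphSet univ = univ := by
  refine eq_univ_of_forall fun x => ?_
  obtain ⟨e, t, ht, rfl⟩ := G.cover x
  exact mem_biUnion (mem_univ e) (mem_image_of_mem _ ht)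

theorem l2normSqOn_univ (G : MetricGraphOn X) (f : X → ℝ) :
    G.l2normSqOn univ f = ∑' e, G.edgeMass f e :=
  tsum_univ (G.edgeMass f)

theorem derivNormSqOn_univ (G : MetricGraphOn X) (f : X → ℝ) :
    G.derivNormSqOn univ f = ∑' e, G.edgeEnergy f e :=
  tsum_univ (G.edgeEnergy f)

theorem edgeMass_nonneg (G : MetricGraphOn X) (f : X → ℝ) (e : G.E) : 0 ≤ G.edgeMass f e :=
  integral_nonneg fun _ => sq_nonneg _

theorem edgeEnergy_nonneg (G : MetricGraphOn X) (f : X → ℝ) (e : G.E) : 0 ≤ G.edgeEnergy f e :=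
  integral_nonneg fun _ => sq_nonneg _

theorem continuousOn_comp_edgeMap (G : MetricGraphOn X) (hf : Continuous f) (e : G.E) :
    ContinuousOn (f ∘ G.edgeMap e) (Icc 0 (G.len e)) :=
  hf.comp_continuousOn (G.edgeMap_cont e)

theorem integrableOn_comp_edgeMap (G : MetricGraphOn X) (hf : Continuous f) (e : G.E) :
    IntegrableOn (fun t => f (G.edgeMap e t)) (Ioo 0 (G.len e)) :=
  (G.continuousOn_comp_edgeMap hf e).integrableOn_Icc.mono_set Ioo_subset_Icc_self

theorem MemH1.isH1On (hf : G.MemH1 f) (e : G.E) : IsH1On (f ∘ G.edgeMap e) (G.len e) :=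
  ⟨G.continuousOn_comp_edgeMap hf.1 e, hf.2.2.1 e (mem_univ e), hf.2.2.2.1 e (mem_univ e)⟩

theorem MemH1.summable_edgeEnergy (hf : G.MemH1 f) : Summable (G.edgeEnergy f) := by
  have h1 : Summable fun e => G.edgeMass f e + G.edgeEnergy f e :=
    (Equiv.Set.univ G.E).symm.summable_iff.2 hf.2.2.2.2
  exact h1.of_nonneg_of_le (G.edgeEnergy_nonneg f) fun e =>
    le_add_of_nonneg_left (G.edgeMass_nonneg f e)

theorem memH1_of_isH1On (hc : Continuous f) (hf : ∀ e, IsH1On (f ∘ G.edgeMap e) (G.len e))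
    (hm : Summable (G.edgeMass f)) (he : Summable (G.edgeEnergy f)) : G.MemH1 f :=
  ⟨hc, hc.continuousOn, fun e _ => (hf e).integrableOn_sq, fun e _ => (hf e).eq_integral,
    (Equiv.Set.univ G.E).summable_iff.2 (hm.add he)⟩

/-- The energy of `f` over the sublevel set of `f` at height `r`. -/
noncomputable def sublevelEnergy (G : MetricGraphOn X) (f : X → ℝ) (r : ℝ) : ℝ :=
  ∑' e, IsH1On.sublevelEnergy (f ∘ G.edgeMap e) (G.len e) r

theorem MemH1.summable_sublevelEnergy (hf : G.MemH1 f) (r : ℝ) :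
    Summable fun e => IsH1On.sublevelEnergy (f ∘ G.edgeMap e) (G.len e) r :=
  hf.summable_edgeEnergy.of_nonneg_of_le (fun _ => IsH1On.sublevelEnergy_nonneg _ _ _)
    fun e => (hf.isH1On e).sublevelEnergy_le r

theorem sublevelEnergy_nonneg (G : MetricGraphOn X) (f : X → ℝ) (r : ℝ) :
    0 ≤ G.sublevelEnergy f r :=
  tsum_nonneg fun _ => IsH1On.sublevelEnergy_nonneg _ _ _

theorem MemH1.sublevelEnergy_le (hf : G.MemH1 f) (r : ℝ) :
    G.sublevelEnergy f r ≤ G.derivNormSqOn univ f := by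
  rw [derivNormSqOn_univ]
  exact (hf.summable_sublevelEnergy r).tsum_le_tsum (fun e => (hf.isH1On e).sublevelEnergy_le r)
    hf.summable_edgeEnergy

theorem MemH1.sublevelEnergy_mono (hf : G.MemH1 f) : Monotone (G.sublevelEnergy f) :=
  fun a b hab => (hf.summable_sublevelEnergy a).tsum_le_tsum
    (fun e => (hf.isH1On e).sublevelEnergy_mono hab) (hf.summable_sublevelEnergy b)

theorem MemH1.edge_sublevelEnergy_sub_le (hf : G.MemH1 f) {a b : ℝ} (hab : a ≤ b) (e : G.E) :
    IsH1On.sublevelEnergy (f ∘ G.edgeMap e) (G.len e) b -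
      IsH1On.sublevelEnergy (f ∘ G.edgeMap e) (G.len e) a ≤
      G.sublevelEnergy f b - G.sublevelEnergy f a := by
  have ha := hf.summable_sublevelEnergy a
  have hb := hf.summable_sublevelEnergy b
  rw [sublevelEnergy, sublevelEnergy, ← hb.tsum_sub ha]
  exact (hb.sub ha).le_tsum e
    fun e' _ => sub_nonneg.2 ((hf.isH1On e').sublevelEnergy_mono hab)

/-- The height `q`, lowered by the energy of `f` below `q`. Its running supremum, composed with
`f`, is `a`-Lipschitz along the edges. -/
noncomputable def loweredHeight (G : MetricGraphOn X) (f : X → ℝ) (a q : ℝ) : ℝ :=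
  q - G.sublevelEnergy f q / (4 * a)

theorem loweredHeight_le (G : MetricGraphOn X) (f : X → ℝ) {a : ℝ} (ha : 0 < a) (q : ℝ) :
    G.loweredHeight f a q ≤ q :=
  sub_le_self _ (div_nonneg (G.sublevelEnergy_nonneg f q) (by positivity))

theorem MemH1.loweredHeight_le_add (hf : G.MemH1 f) {a : ℝ} (ha : 0 < a) {r q : ℝ} (h : r ≤ q) :
    G.loweredHeight f a q ≤ G.loweredHeight f a r + (q - r) := by
  have := div_le_div_of_nonneg_right (hf.sublevelEnergy_mono h) (by positivity : 0 ≤ 4 * a)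
  simp only [loweredHeight]
  linarith

theorem MemH1.abs_runningSup_sub_le (hf : G.MemH1 f) {a : ℝ} (ha : 0 < a) (e : G.E) {s t : ℝ}
    (hs : s ∈ Icc 0 (G.len e)) (ht : t ∈ Icc 0 (G.len e)) :
    |runningSup (G.loweredHeight f a) (f (G.edgeMap e s)) -
      runningSup (G.loweredHeight f a) (f (G.edgeMap e t))| ≤ a * |s - t| := by
  have hA := G.loweredHeight_le f ha
  wlog hle : f (G.edgeMap e s) ≤ f (G.edgeMap e t) generalizing s t
  · rw [abs_sub_comm, abs_sub_comm s]
    exact this ht hs (le_of_not_ge hle)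
  rw [abs_sub_comm, abs_of_nonneg (sub_nonneg.2 (runningSup_mono hA hle)), sub_le_iff_le_add']
  refine runningSup_le_add hA (by positivity) fun q hq => ?_
  have hsub : uIcc s t ⊆ Icc 0 (G.len e) := uIcc_subset_Icc hs ht
  obtain ⟨σ, hσ, rfl⟩ := intermediate_value_uIcc ((hf.isH1On e).continuousOn.mono hsub)
    (Icc_subset_uIcc (Ioc_subset_Icc_self hq))
  have h1 := (hf.isH1On e).sub_sublevelEnergy_le ha hs (hsub hσ) hq.1
  have h2 := div_le_div_of_nonneg_right (hf.edge_sublevelEnergy_sub_le hq.1.le e)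
    (by positivity : 0 ≤ 4 * a)
  have h3 : a * |s - σ| ≤ a * |s - t| := by
    gcongr 1
    rw [abs_sub_comm s σ, abs_sub_comm s t]
    exact abs_sub_left_of_mem_uIcc hσ
  rw [sub_div (G.sublevelEnergy f _)] at h2
  simp only [loweredHeight, Function.comp_apply] at h1 h2 ⊢
  linarith

theorem MemH1.sub_le (hf : G.MemH1 f) {a : ℝ} (ha : 0 < a) (x y : X) :
    f x - f y ≤ a * dist x y + G.derivNormSqOn univ f / (4 * a) := by
  have hA := G.loweredHeight_le f ha
  set Φ := runningSup (G.loweredHeight f a) with hΦ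
  have hcont : Continuous Φ := continuous_runningSup hA fun r q h => hf.loweredHeight_le_add ha h
  have h1 := G.dist_ge (fun z => a⁻¹ * Φ (f z)) (continuous_const.mul (hcont.comp hf.1))
    (fun e s hs t ht => by
      rw [← mul_sub, abs_mul, abs_of_pos (inv_pos.2 ha), inv_mul_le_iff₀ ha]
      exact hf.abs_runningSup_sub_le ha e hs ht) x y
  rw [← mul_sub, inv_mul_le_iff₀ ha] at h1
  have h2 : Φ (f y) ≤ f y := runningSup_le fun q hq => (hA q).trans hq
  have h3 : f x - G.sublevelEnergy f (f x) / (4 * a) ≤ Φ (f x) := le_runningSup hA le_rfl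
  have h4 := div_le_div_of_nonneg_right (hf.sublevelEnergy_le (f x)) (by positivity : 0 ≤ 4 * a)
  linarith

theorem derivNormSqOn_univ_nonneg (G : MetricGraphOn X) (f : X → ℝ) :
    0 ≤ G.derivNormSqOn univ f := by
  rw [derivNormSqOn_univ]
  exact tsum_nonneg (G.edgeEnergy_nonneg f)

/-- Functions in `H¹(G)` are `1/2`-Hölder continuous, with the energy as constant. -/
theorem MemH1.sq_sub_le (hf : G.MemH1 f) (x y : X) :
    (f x - f y) ^ 2 ≤ dist x y * G.derivNormSqOn univ f := by
  wlog hlt : f y < f x generalizing x y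
  · rcases (not_lt.1 hlt).eq_or_lt with heq | hlt
    · rw [heq, sub_self, zero_pow two_ne_zero]
      exact mul_nonneg dist_nonneg (G.derivNormSqOn_univ_nonneg f)
    · rw [dist_comm, ← neg_sq, neg_sub]
      exact this y x hlt
  have hd : 0 < dist x y := dist_pos.2 fun h => hlt.ne (by rw [h])
  have hδ : 0 < f x - f y := sub_pos.2 hlt
  have h1 := hf.sub_le (a := (f x - f y) / (2 * dist x y)) (by positivity) x y
  set E := G.derivNormSqOn univ f
  set δ := f x - f y
  have h2 : δ / (2 * dist x y) * dist x y + E / (4 * (δ / (2 * dist x y))) =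
      δ / 2 + E * dist x y / (2 * δ) := by
    field_simp
    ring
  rw [h2, ← sub_le_iff_le_add', le_div_iff₀ (by positivity)] at h1
  linarith

theorem MemH1.exists_abs_le (hf : G.MemH1 f) (hb : Bornology.IsBounded (univ : Set X)) :
    ∃ C, ∀ x, |f x| ≤ C := by
  rcases isEmpty_or_nonempty X with _ | ⟨⟨y⟩⟩
  · exact ⟨0, fun x => isEmptyElim x⟩
  refine ⟨|f y| + √(Metric.diam (univ : Set X) * G.derivNormSqOn univ f), fun x => ?_⟩
  have h1 : |f x - f y| ≤ √(Metric.diam (univ : Set X) * G.derivNormSqOn univ f) :=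
    Real.abs_le_sqrt ((hf.sq_sub_le x y).trans (mul_le_mul_of_nonneg_right
      (Metric.dist_le_diam_of_mem hb (mem_univ x) (mem_univ y)) (G.derivNormSqOn_univ_nonneg f)))
  linarith [abs_sub_abs_le_abs_sub (f x) (f y)]

/-- `∫_e f` along a single edge. -/
noncomputable def edgeIntegral (G : MetricGraphOn X) (f : X → ℝ) (e : G.E) : ℝ :=
  ∫ t in Ioo 0 (G.len e), f (G.edgeMap e t)

theorem integral_const_edge (G : MetricGraphOn X) (c : ℝ) (e : G.E) :
    ∫ _ in Ioo 0 (G.len e), c = c * G.len e := by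
  simp [(G.len_pos e).le, mul_comm]

theorem edgeMass_le (hf : Continuous f) {C : ℝ} (hC : ∀ x, f x ^ 2 ≤ C) (e : G.E) :
    G.edgeMass f e ≤ C * G.len e := by
  rw [← G.integral_const_edge]
  exact integral_mono (G.integrableOn_comp_edgeMap (hf.pow 2) e) (integrable_const C)
    fun t => hC _

theorem summable_edgeMass (hs : Summable G.len) (hf : Continuous f) (hb : ∃ C, ∀ x, |f x| ≤ C) :
    Summable (G.edgeMass f) := by
  obtain ⟨C, hC⟩ := hb
  refine (hs.mul_left (C ^ 2)).of_nonneg_of_le (G.edgeMass_nonneg f) fun e => ?_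
  exact edgeMass_le hf (fun x => by rw [← sq_abs]; gcongr; exact hC x) e

theorem summable_edgeIntegral (hs : Summable G.len) (hb : ∃ C, ∀ x, |f x| ≤ C) :
    Summable (G.edgeIntegral f) := by
  obtain ⟨C, hC⟩ := hb
  refine (hs.mul_left C).of_norm_bounded fun e => ?_
  refine (norm_setIntegral_le_of_norm_le_const (by simp) fun t _ => hC _).trans_eq ?_
  simp [Measure.real, (G.len_pos e).le]

theorem tsum_edgeMass_le (hs : Summable G.len) (hf : Continuous f) {C : ℝ}
    (hC : ∀ x, f x ^ 2 ≤ C) : ∑' e, G.edgeMass f e ≤ C * ∑' e, G.len e := by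
  rw [← tsum_mul_left]
  refine Summable.tsum_le_tsum (edgeMass_le hf hC) ?_ (hs.mul_left C)
  exact summable_edgeMass hs hf ⟨√C, fun x => Real.abs_le_sqrt (hC x)⟩

theorem edgeMass_const_add_mul (hf : Continuous f) (a b : ℝ) (e : G.E) :
    G.edgeMass (fun x => a + b * f x) e =
      a ^ 2 * G.len e + 2 * a * b * G.edgeIntegral f e + b ^ 2 * G.edgeMass f e := by
  have h1 := G.integrableOn_comp_edgeMap hf e
  have h2 : IntegrableOn (fun t => f (G.edgeMap e t) ^ 2) (Ioo 0 (G.len e)) :=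
    G.integrableOn_comp_edgeMap (hf.pow 2) e
  have h3 : IntegrableOn (fun t => a ^ 2 + 2 * a * b * f (G.edgeMap e t)) (Ioo 0 (G.len e)) :=
    (integrable_const _).add (h1.const_mul _)
  rw [edgeMass, edgeIntegral, edgeMass, ← integral_const_mul, ← integral_const_mul,
    ← G.integral_const_edge, ← integral_add (integrable_const _) (h1.const_mul _),
    ← integral_add h3 (h2.const_mul _)]
  congr 1 with t
  ring

theorem tsum_edgeMass_const_add_mul (hs : Summable G.len) (hf : Continuous f)
    (hb : ∃ C, ∀ x, |f x| ≤ C) (a b : ℝ) :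
    ∑' e, G.edgeMass (fun x => a + b * f x) e =
      a ^ 2 * ∑' e, G.len e + 2 * a * b * ∑' e, G.edgeIntegral f e +
        b ^ 2 * ∑' e, G.edgeMass f e := by
  have h1 := (hs.mul_left (a ^ 2))
  have h2 := (summable_edgeIntegral hs hb).mul_left (2 * a * b)
  have h3 := (summable_edgeMass hs hf hb).mul_left (b ^ 2)
  simp_rw [edgeMass_const_add_mul hf]
  rw [(h1.add h2).tsum_add h3, h1.tsum_add h2, tsum_mul_left, tsum_mul_left, tsum_mul_left]

theorem tsum_edgeIntegral_linearCombination (hs : Summable G.len) (hf : Continuous f)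
    (hh : Continuous h) (hfb : ∃ C, ∀ x, |f x| ≤ C) (hhb : ∃ C, ∀ x, |h x| ≤ C) (a b : ℝ) :
    ∑' e, G.edgeIntegral (fun x => a * f x + b * h x) e =
      a * ∑' e, G.edgeIntegral f e + b * ∑' e, G.edgeIntegral h e := by
  rw [← tsum_mul_left, ← tsum_mul_left, ← ((summable_edgeIntegral hs hfb).mul_left a).tsum_add
    ((summable_edgeIntegral hs hhb).mul_left b)]
  congr 1 with e
  rw [edgeIntegral, edgeIntegral, edgeIntegral, ← integral_const_mul, ← integral_const_mul,
    ← integral_add ((G.integrableOn_comp_edgeMap hf e).const_mul a)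
      ((G.integrableOn_comp_edgeMap hh e).const_mul b)]

theorem tsum_edgeMass_pos (hs : Summable G.len) (hf : Continuous f) (hb : ∃ C, ∀ x, |f x| ≤ C)
    {x : X} (hx : f x ≠ 0) : 0 < ∑' e, G.edgeMass f e := by
  obtain ⟨e, t, ht, rfl⟩ := G.cover x
  refine (summable_edgeMass hs hf hb).tsum_pos (G.edgeMass_nonneg f) e ?_
  rw [edgeMass, ← integral_Ioc_eq_integral_Ioo, ← intervalIntegral.integral_of_le (G.len_pos e).le]
  exact intervalIntegral.integral_pos (G.len_pos e) ((G.continuousOn_comp_edgeMap hf e).pow 2)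
    (fun _ _ => sq_nonneg _) ⟨t, ht, by positivity⟩

theorem MemH1.linearCombination (hf : G.MemH1 f) (hh : G.MemH1 h) (hs : Summable G.len)
    (hb : Bornology.IsBounded (univ : Set X)) (a b : ℝ) :
    G.MemH1 fun x => a * f x + b * h x := by
  have hc : Continuous fun x => a * f x + b * h x :=
    (continuous_const.mul hf.1).add (continuous_const.mul hh.1)
  refine memH1_of_isH1On hc (fun e => (hf.isH1On e).linearCombination (hh.isH1On e) a b)
    (summable_edgeMass hs hc ?_) ?_
  · obtain ⟨C, hC⟩ := hf.exists_abs_le hb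
    obtain ⟨C', hC'⟩ := hh.exists_abs_le hb
    refine ⟨|a| * C + |b| * C', fun x => (abs_add_le _ _).trans ?_⟩
    rw [abs_mul, abs_mul]
    gcongr
    exacts [hC x, hC' x]
  · exact ((hf.summable_edgeEnergy.mul_left (2 * a ^ 2)).add
      (hh.summable_edgeEnergy.mul_left (2 * b ^ 2))).of_nonneg_of_le (G.edgeEnergy_nonneg _)
      fun e => (hf.isH1On e).integral_sq_deriv_linearCombination_le (hh.isH1On e) a b

/-- A Poincaré inequality for functions of mean zero. -/
theorem MemH1.poincare [Nonempty X] (hf : G.MemH1 f) (hs : Summable G.len)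
    (hb : Bornology.IsBounded (univ : Set X)) (hmean : ∑' e, G.edgeIntegral f e = 0) :
    2 * ∑' e, G.edgeMass f e ≤
      (∑' e, G.len e) * Metric.diam (univ : Set X) * G.derivNormSqOn univ f := by
  have hfb := hf.exists_abs_le hb
  have hL : 0 < ∑' e, G.len e := by
    obtain ⟨e, -⟩ := G.cover (Classical.arbitrary X)
    exact hs.tsum_pos (fun e => (G.len_pos e).le) e (G.len_pos e)
  set L := ∑' e, G.len e
  set M := ∑' e, G.edgeMass f e
  set B := Metric.diam (univ : Set X) * G.derivNormSqOn univ f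
  have hosc : ∀ x y, (-f y + 1 * f x) ^ 2 ≤ B := fun x y => by
    rw [one_mul, neg_add_eq_sub]
    exact (hf.sq_sub_le x y).trans (mul_le_mul_of_nonneg_right
      (Metric.dist_le_diam_of_mem hb (mem_univ x) (mem_univ y)) (G.derivNormSqOn_univ_nonneg f))
  have hpt : ∀ y, f y ^ 2 ≤ B - M / L := fun y => by
    have h1 := tsum_edgeMass_le (f := fun x => -f y + 1 * f x) hs
      (continuous_const.add (continuous_const.mul hf.1)) fun x => hosc x y
    rw [tsum_edgeMass_const_add_mul hs hf.1 hfb, hmean] at h1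
    rw [le_sub_iff_add_le', div_add' _ _ _ hL.ne', div_le_iff₀ hL]
    linarith
  have h2 := tsum_edgeMass_le hs hf.1 hpt
  rw [sub_mul, div_mul_cancel₀ _ hL.ne'] at h2
  rw [mul_assoc]
  linarith

theorem memH1_of_lipschitzOnWith (hs : Summable G.len) (hf : Continuous f)
    (hb : ∃ C, ∀ x, |f x| ≤ C) (hl : ∀ e, LipschitzOnWith 1 (f ∘ G.edgeMap e) (Icc 0 (G.len e))) :
    G.MemH1 f :=
  memH1_of_isH1On hf (fun e => (hl e).isH1On) (summable_edgeMass hs hf hb)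
    (hs.of_nonneg_of_le (G.edgeEnergy_nonneg f)
      fun e => (hl e).integral_sq_deriv_le (G.len_pos e).le)

theorem memH1_one (hs : Summable G.len) : G.MemH1 fun _ => 1 :=
  memH1_of_lipschitzOnWith hs continuous_const ⟨1, fun _ => by simp⟩
    fun _ => (LipschitzWith.const' (1 : ℝ)).lipschitzOnWith

theorem memH1_dist (hs : Summable G.len) (hb : Bornology.IsBounded (univ : Set X)) (x : X) :
    G.MemH1 (dist x) := by
  refine memH1_of_lipschitzOnWith hs (continuous_const.dist continuous_id)
    ⟨Metric.diam (univ : Set X), fun y => ?_⟩ fun e => ?_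
  · rw [abs_of_nonneg dist_nonneg]
    exact Metric.dist_le_diam_of_mem hb (mem_univ x) (mem_univ y)
  · have h1 : LipschitzOnWith 1 (G.edgeMap e) (Icc 0 (G.len e)) :=
      .of_dist_le_mul fun s hs t ht => by simpa [Real.dist_eq] using G.dist_le e s hs t ht
    simpa using (LipschitzWith.dist_right x).comp_lipschitzOnWith h1

theorem derivNormSqOn_univ_const_add_mul (G : MetricGraphOn X) (f : X → ℝ) (a b : ℝ) :
    G.derivNormSqOn univ (fun x => a + b * f x) = b ^ 2 * G.derivNormSqOn univ f := by
  have h1 : ∀ e, G.edgeDeriv (fun x => a + b * f x) e = fun t => b * G.edgeDeriv f e t :=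
    fun e => funext fun t => by
      change deriv (fun t => a + b * (f ∘ G.edgeMap e) t) t = _
      rw [deriv_const_add, deriv_const_mul_field]
      rfl
  simp_rw [derivNormSqOn_univ, edgeEnergy, h1, mul_pow, integral_const_mul, tsum_mul_left]

/-- The Rayleigh quotient is bounded on the span of `1` and a nonconstant function. -/
theorem exists_derivNormSqOn_const_add_mul_le (hs : Summable G.len) (hf : Continuous f)
    (hb : ∃ C, ∀ x, |f x| ≤ C) {x y : X} (hxy : f x ≠ f y) :
    ∃ μ, ∀ a b : ℝ, G.derivNormSqOn univ (fun z => a + b * f z) ≤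
      μ * G.l2normSqOn univ fun z => a + b * f z := by
  have hL : 0 < ∑' e, G.len e := by
    obtain ⟨e, -⟩ := G.cover x
    exact hs.tsum_pos (fun e => (G.len_pos e).le) e (G.len_pos e)
  set L := ∑' e, G.len e with hLdef
  set S := ∑' e, G.edgeIntegral f e
  set κ := ∑' e, G.edgeMass (fun z => -(S / L) + 1 * f z) e with hκdef
  have hκ : 0 < κ := by
    obtain ⟨C, hC⟩ := hb
    obtain ⟨z, hz⟩ : ∃ z, -(S / L) + 1 * f z ≠ 0 := by
      by_contra! hz
      exact hxy (by linarith [hz x, hz y])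
    exact tsum_edgeMass_pos (f := fun z => -(S / L) + 1 * f z) hs
      (continuous_const.add (continuous_const.mul hf))
      ⟨|-(S / L)| + C, fun z => (abs_add_le _ _).trans (by rw [one_mul]; gcongr; exact hC z)⟩ hz
  refine ⟨G.derivNormSqOn univ f / κ, fun a b => ?_⟩
  rw [derivNormSqOn_univ_const_add_mul, l2normSqOn_univ, div_mul_eq_mul_div, le_div_iff₀ hκ,
    mul_right_comm, mul_comm (b ^ 2 * κ)]
  refine mul_le_mul_of_nonneg_left ?_ (G.derivNormSqOn_univ_nonneg f)
  rw [hκdef, tsum_edgeMass_const_add_mul hs hf hb, tsum_edgeMass_const_add_mul hs hf hb, ← hLdef,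
    ← sub_nonneg]
  refine (mul_nonneg hL.le (sq_nonneg (a + b * S / L))).trans_eq ?_
  field_simp
  ring

theorem exists_eigenOn_two_bound (hs : Summable G.len) (hb : Bornology.IsBounded (univ : Set X))
    [Nontrivial X] : ∃ (μ : ℝ) (φ : Fin 2 → X → ℝ), (∀ i, G.MemH1 (φ i)) ∧
      LinearIndependent ℝ (fun i => (G.subgraphSet univ).restrict (φ i)) ∧
      ∀ c : Fin 2 → ℝ, G.derivNormSqOn univ (∑ i, c i • φ i) ≤
        μ * G.l2normSqOn univ (∑ i, c i • φ i) := by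
  obtain ⟨x, y, hxy⟩ := exists_pair_ne X
  have hd := memH1_dist hs hb x
  obtain ⟨μ, hμ⟩ := exists_derivNormSqOn_const_add_mul_le hs hd.1 (hd.exists_abs_le hb)
    (x := x) (y := y) (by rw [dist_self]; exact (dist_pos.2 hxy).ne)
  refine ⟨μ, ![fun _ => 1, dist x], Fin.forall_fin_two.2 ⟨memH1_one hs, hd⟩,
    Fintype.linearIndependent_iff.2 fun c hc => ?_, fun c => ?_⟩
  · rw [Fin.sum_univ_two] at hc
    have hmem : ∀ z, z ∈ G.subgraphSet univ := fun z => G.subgraphSet_univ ▸ mem_univ z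
    have h0 : c 0 * 1 + c 1 * dist x x = 0 := congrFun hc ⟨x, hmem x⟩
    have h1 : c 0 * 1 + c 1 * dist x y = 0 := congrFun hc ⟨y, hmem y⟩
    have hc0 : c 0 = 0 := by simpa using h0
    exact Fin.forall_fin_two.2 ⟨hc0, by simpa [hc0, hxy] using h1⟩
  · have hsum : ∑ i, c i • (![fun _ => 1, dist x] : Fin 2 → X → ℝ) i =
        fun z => c 0 + c 1 * dist x z := by
      ext z
      simp [Fin.sum_univ_two]
    rw [hsum]
    exact hμ _ _

/-- Every two-dimensional space of functions contains a nonzero one of mean zero. -/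
theorem exists_mean_zero (hs : Summable G.len) (hb : Bornology.IsBounded (univ : Set X))
    {φ : Fin 2 → X → ℝ} (hφ : ∀ i, G.MemH1 (φ i))
    (hli : LinearIndependent ℝ (fun i => (G.subgraphSet univ).restrict (φ i))) :
    ∃ c : Fin 2 → ℝ, G.MemH1 (∑ i, c i • φ i) ∧ (∃ x, (∑ i, c i • φ i) x ≠ 0) ∧
      ∑' e, G.edgeIntegral (∑ i, c i • φ i) e = 0 := by
  set S := fun i => ∑' e, G.edgeIntegral (φ i) e
  obtain ⟨c, hc, hmean⟩ : ∃ c : Fin 2 → ℝ, c ≠ 0 ∧ c 0 * S 0 + c 1 * S 1 = 0 := by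
    by_cases h0 : S 0 = 0
    · exact ⟨![1, 0], fun h => one_ne_zero (congrFun h 0), by simp [h0]⟩
    · exact ⟨![S 1, -S 0], fun h => h0 (neg_eq_zero.1 (congrFun h 1)), by simp [mul_comm]⟩
  have hsum : ∑ i, c i • φ i = fun z => c 0 * φ 0 z + c 1 * φ 1 z := by
    ext z
    simp [Fin.sum_univ_two]
  refine ⟨c, ?_, ?_, ?_⟩
  · rw [hsum]
    exact (hφ 0).linearCombination (hφ 1) hs hb _ _
  · by_contra! hz
    refine hc (funext (Fintype.linearIndependent_iff.1 hli c (funext fun z => ?_)))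
    have := hz z
    rw [Fin.sum_univ_two] at this ⊢
    exact this
  · rw [hsum, tsum_edgeIntegral_linearCombination hs (hφ 0).1 (hφ 1).1 ((hφ 0).exists_abs_le hb)
      ((hφ 1).exists_abs_le hb)]
    exact hmean

end MetricGraphOn

open MetricGraphOn in
/-- Let `G` be a locally finite, connected metric graph with finite
total length `L > 0`, finite diameter `D > 0`, and finite Betti number. Then
`μ_2(G) ≥ 2/(LD)`. -/
theorem statement14 (X : Type) [MetricSpace X] (G : MetricGraphOn X)
    (hlf : G.LocallyFinite) (hconn : ConnectedSpace X)
    (hsum : Summable G.len) (L : ℝ) (hL : L = ∑' e : G.E, G.len e) (hLpos : 0 < L)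
    (hbdd : Bornology.IsBounded (Set.univ : Set X))
    (D : ℝ) (hD : D = Metric.diam (Set.univ : Set X)) (hDpos : 0 < D)
    (hbetti : ∃ β : ℕ, G.HasBettiNumber β) :
    2 / (L * D) ≤ G.neumannEigen 2 := by
  subst hL hD
  have : Nontrivial X := by
    by_contra hX
    rw [not_nontrivial_iff_subsingleton] at hX
    exact hDpos.ne' (Metric.diam_subsingleton subsingleton_univ)
  refine le_csInf (exists_eigenOn_two_bound hsum hbdd) ?_
  rintro μ ⟨φ, hφ, hli, hμ⟩
  obtain ⟨c, hc, ⟨x, hx⟩, hmean⟩ := exists_mean_zero hsum hbdd hφ hli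
  have hpos := tsum_edgeMass_pos hsum hc.1 (hc.exists_abs_le hbdd) hx
  have h1 := hc.poincare hsum hbdd hmean
  have h2 := hμ c
  rw [l2normSqOn_univ] at h2
  have hLD := mul_pos hLpos hDpos
  rw [div_le_iff₀ hLD]
  refine le_of_mul_le_mul_right (h1.trans ?_) hpos
  rw [mul_comm μ, mul_assoc _ μ]
  exact mul_le_mul_of_nonneg_left h2 hLD.le
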